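/- arXiv:1807.01951 — 8 statements merged into one kernel-verified Lean document; each statement's English description precedes it below -/
import Mathlib

section
/- Let G be a group which has a subgroup that is not finitely generated (equivalently, G does not satisfy the maximal condition on subgroups). Then there exists a set X ⊆ (G → ZMod 2) which is closed in the product topology, invariant under the shift action of G, and a subgroup of the product group (G → ZMod 2) under pointwise addition, but which is not of finite type: there is no clopen set C ⊆ (G → ZMod 2) such that for all x, x ∈ X if and only if g • x ∈ C for all g ∈ G. -/
/-- The product topology on `G → A` where the alphabet `A` carries the discrete topology. -/
def prodTop (G A : Type*) : TopologicalSpace (G → A) :=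
  @Pi.topologicalSpace G (fun _ => A) (fun _ => ⊥)

/-- The shift action of a group `G` on `G → A`: `(g • x) h = x (g⁻¹ * h)`. -/
def shift {G : Type*} [Group G] {A : Type*} (g : G) (x : G → A) : G → A :=
  fun h => x (g⁻¹ * h)

/-- A subshift `X ⊆ A^G` is of finite type if there is a clopen set `C` such that
`x ∈ X` iff all shifts of `x` lie in `C`. -/
def IsSFT {G : Type*} [Group G] (A : Type*) (X : Set (G → A)) : Prop :=
  ∃ C : Set (G → A), @IsClopen _ (prodTop G A) C ∧ ∀ x, x ∈ X ↔ ∀ g : G, shift g x ∈ C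

/-- Over a finite discrete alphabet, membership in a clopen set is determined by
finitely many coordinates. -/
theorem IsClopen.exists_finset_forall_mem_of_eqOn {ι A : Type*} [TopologicalSpace A]
    [DiscreteTopology A] [Finite A] {C : Set (ι → A)} (hC : IsClopen C) :
    ∃ F : Finset ι, ∀ x y : ι → A, (∀ i ∈ F, x i = y i) → x ∈ C → y ∈ C := by
  classical
  have cyl : ∀ x ∈ C, ∃ I : Finset ι, ∀ y : ι → A, (∀ i ∈ I, y i = x i) → y ∈ C := by
    intro x hx
    obtain ⟨I, u, hu, hIC⟩ := isOpen_pi_iff.1 hC.isOpen x hx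
    exact ⟨I, fun y hy => hIC fun i hi => by rw [hy i hi]; exact (hu i hi).2⟩
  choose! I hI using cyl
  obtain ⟨t, htC, ht⟩ := hC.isClosed.isCompact.elim_nhds_subcover
    (fun x => (I x : Set ι).pi fun i => {x i})
    (fun x _ => set_pi_mem_nhds (I x).finite_toSet fun i _ => by simp)
  refine ⟨t.biUnion I, fun x y hxy hx => ?_⟩
  obtain ⟨z, hz, hxz⟩ := Set.mem_iUnion₂.1 (ht hx)
  exact hI z (htC z hz) y fun i hi =>
    (hxy i (Finset.mem_biUnion.2 ⟨z, hz, hi⟩)).symm.trans (hxz i hi)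

/-- The configurations that are constant on the left cosets of `H`. -/
def cosetShift {G : Type*} [Group G] (H : Subgroup G) (A : Type*) [AddGroup A] :
    AddSubgroup (G → A) where
  carrier := {x | ∀ g, ∀ h ∈ H, x (g * h) = x g}
  zero_mem' _ _ _ := rfl
  add_mem' hx hy g h hh := congrArg₂ (· + ·) (hx g h hh) (hy g h hh)
  neg_mem' hx g h hh := congrArg Neg.neg (hx g h hh)

theorem shift_mem_cosetShift {G : Type*} [Group G] {H : Subgroup G} {A : Type*} [AddGroup A]
    (g : G) {x : G → A} (hx : x ∈ cosetShift H A) : shift g x ∈ cosetShift H A := by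
  intro k h hh
  simpa only [shift, mul_assoc] using hx (g⁻¹ * k) h hh

theorem isClosed_cosetShift {G : Type*} [Group G] (H : Subgroup G) (A : Type*) [AddGroup A]
    [TopologicalSpace A] [T2Space A] : IsClosed (cosetShift H A : Set (G → A)) := by
  have : (cosetShift H A : Set (G → A)) = ⋂ g, ⋂ h ∈ H, {x | x (g * h) = x g} := by
    ext x
    simp [cosetShift]
  rw [this]
  exact isClosed_iInter fun g => isClosed_iInter fun h => isClosed_iInter fun _ =>
    isClosed_eq (continuous_apply _) (continuous_apply _)

/-- If the left cosets of `K` contain all coincidences on `F` of left cosets of `H`, then a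
configuration constant on left cosets of `K` agrees on `F` with one constant on left cosets
of `H`. -/
theorem exists_mem_cosetShift_eqOn {G : Type*} [Group G] {H K : Subgroup G} {A : Type*}
    [AddGroup A] {F : Finset G} (hK : ∀ a ∈ F, ∀ b ∈ F, a⁻¹ * b ∈ H → a⁻¹ * b ∈ K)
    {x : G → A} (hx : x ∈ cosetShift K A) :
    ∃ y ∈ cosetShift H A, ∀ a ∈ F, y a = x a := by
  classical
  let r : G ⧸ H → A := fun q => if hq : ∃ a ∈ F, (a : G ⧸ H) = q then x hq.choose else 0
  refine ⟨fun g => r g, fun g h hh => ?_, fun a ha => ?_⟩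
  · exact congrArg r (QuotientGroup.mk_mul_of_mem g hh)
  · have ha' : ∃ b ∈ F, (b : G ⧸ H) = a := ⟨a, ha, rfl⟩
    obtain ⟨hb, hba⟩ := ha'.choose_spec
    have := hx ha'.choose _ (hK _ hb a ha (QuotientGroup.eq.1 hba))
    rw [mul_inv_cancel_left] at this
    simp only [r, dif_pos ha', this]

theorem not_isSFT_cosetShift {G : Type*} [Group G] {H : Subgroup G} (hH : ¬ H.FG)
    (A : Type*) [AddGroup A] [Finite A] [Nontrivial A] :
    ¬ IsSFT A (cosetShift H A : Set (G → A)) := by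
  classical
  rintro ⟨C, hC, hXC⟩
  obtain ⟨F, hF⟩ := @IsClopen.exists_finset_forall_mem_of_eqOn G A ⊥ (@DiscreteTopology.mk A ⊥ rfl) _ C hC
  let s : Finset G := ((F ×ˢ F).image fun p => p.1⁻¹ * p.2).filter (· ∈ H)
  let K : Subgroup G := Subgroup.closure s
  have hKH : K ≤ H := (Subgroup.closure_le H).2 fun a ha => (Finset.mem_filter.1 ha).2
  have hK : ∀ a ∈ F, ∀ b ∈ F, a⁻¹ * b ∈ H → a⁻¹ * b ∈ K := fun a ha b hb hab =>
    Subgroup.subset_closure (Finset.mem_filter.2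
      ⟨Finset.mem_image.2 ⟨(a, b), Finset.mem_product.2 ⟨ha, hb⟩, rfl⟩, hab⟩)
  obtain ⟨c, hc⟩ := exists_ne (0 : A)
  let x : G → A := fun g => if g ∈ K then c else 0
  have hx : x ∈ cosetShift K A := fun g h hh => by
    simp only [x, K.mul_mem_cancel_right hh]
  have hxH : x ∈ cosetShift H A := (hXC x).2 fun g => by
    obtain ⟨y, hy, hyx⟩ := exists_mem_cosetShift_eqOn hK (shift_mem_cosetShift g hx)
    refine hF y _ hyx ?_
    have hy1 : shift 1 y = y := by
      funext h
      simp [shift]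
    exact hy1 ▸ (hXC y).1 hy 1
  refine hH ((hKH.antisymm fun h hh => ?_) ▸ ⟨s, rfl⟩)
  by_contra hhK
  have := hxH 1 h hh
  simp only [x, one_mul, if_neg hhK, if_pos K.one_mem] at this
  exact hc this.symm

/-- If a group `G` has a subgroup that is not finitely generated, then `G` carries an
abelian group shift over `ZMod 2` that is not of finite type. -/
theorem stmt_0 {G : Type*} [Group G] (hG : ∃ H : Subgroup G, ¬ H.FG) :
    ∃ X : Set (G → ZMod 2),
      @IsClosed _ (prodTop G (ZMod 2)) X ∧
      (∀ (g : G) (x : G → ZMod 2), x ∈ X → shift g x ∈ X) ∧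
      (∃ S : AddSubgroup (G → ZMod 2), ↑S = X) ∧
      ¬ IsSFT (ZMod 2) X := by
  obtain ⟨H, hH⟩ := hG
  refine ⟨cosetShift H (ZMod 2), ?_, fun g _ => shift_mem_cosetShift g, ⟨_, rfl⟩,
    not_isSFT_cosetShift hH _⟩
  let _ : TopologicalSpace (ZMod 2) := ⊥
  have : DiscreteTopology (ZMod 2) := ⟨rfl⟩
  exact isClosed_cosetShift H (ZMod 2)
end

section
/- Let G be a group that is not finitely generated. Then the two-element set X = {x₀, x₁} ⊆ (G → ZMod 2), where x₀ is the constant function 0 and x₁ is the constant function 1, is closed in the product topology, invariant under the shift action, and a subgroup of (G → ZMod 2) under pointwise addition, but X is not of finite type: there is no clopen set C ⊆ (G → ZMod 2) such that for all x, x ∈ X if and only if g • x ∈ C for all g ∈ G. -/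
/-- An open set in the prodiscrete topology contains, around each of its points, a cylinder
supported on finitely many coordinates. -/
theorem exists_finset_forall_eqOn_mem {G A : Type*} {C : Set (G → A)}
    (hC : @IsOpen _ (prodTop G A) C) {x : G → A} (hx : x ∈ C) :
    ∃ F : Finset G, ∀ y : G → A, (∀ h ∈ F, y h = x h) → y ∈ C := by
  let : TopologicalSpace A := ⊥
  obtain ⟨F, u, hu, hFC⟩ := isOpen_pi_iff.mp hC x hx
  refine ⟨F, fun y hy => hFC fun h hh => ?_⟩
  rw [hy h hh]
  exact (hu h hh).2

/-- Over a group that is not finitely generated, the pair formed by two distinct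
constant configurations is not of finite type. -/
theorem not_isSFT_pair_const {G : Type*} [Group G] (hG : ¬ Group.FG G) {A : Type*} {a b : A}
    (hab : a ≠ b) : ¬ IsSFT A ({fun _ => a, fun _ => b} : Set (G → A)) := by
  classical
  rintro ⟨C, hC, hX⟩
  have ha : (fun _ : G => a) ∈ C := (hX fun _ => a).mp (Or.inl rfl) 1
  have hb : (fun _ : G => b) ∈ C := (hX fun _ => b).mp (Or.inr rfl) 1
  obtain ⟨Fa, hFa⟩ := exists_finset_forall_eqOn_mem hC.2 ha
  obtain ⟨Fb, hFb⟩ := exists_finset_forall_eqOn_mem hC.2 hb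
  let H : Subgroup G := Subgroup.closure ↑(Fa ∪ Fb)
  have hFH : ∀ h ∈ Fa ∪ Fb, h ∈ H := fun h hh => Subgroup.subset_closure hh
  obtain ⟨k, hk⟩ : ∃ k, k ∉ H := by
    by_contra! hall
    exact hG ⟨⟨Fa ∪ Fb, (Subgroup.eq_top_iff' H).mpr hall⟩⟩
  have hmem : (fun h => if h ∈ H then b else a) ∈ ({fun _ => a, fun _ => b} : Set (G → A)) := by
    refine (hX _).mpr fun g => ?_
    by_cases hg : g⁻¹ ∈ H
    · refine hFb _ fun h hh => if_pos ?_
      exact H.mul_mem hg (hFH h (Finset.mem_union_right _ hh))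
    · refine hFa _ fun h hh => if_neg ?_
      rwa [H.mul_mem_cancel_right (hFH h (Finset.mem_union_left _ hh))]
  rcases hmem with h | h
  · exact hab (by simpa [H.one_mem] using (congrFun h 1).symm)
  · exact hab (by simpa [hk] using congrFun h k)

/-- If `G` is not finitely generated, then the two-point group shift
`{const 0, const 1} ⊆ (G → ZMod 2)` is a closed, shift-invariant subgroup
that is not of finite type. -/
theorem stmt_1 {G : Type*} [Group G] (hG : ¬ Group.FG G) :
    @IsClosed _ (prodTop G (ZMod 2))
      ({fun _ => 0, fun _ => 1} : Set (G → ZMod 2)) ∧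
    (∀ (g : G) (x : G → ZMod 2),
      x ∈ ({fun _ => 0, fun _ => 1} : Set (G → ZMod 2)) →
        shift g x ∈ ({fun _ => 0, fun _ => 1} : Set (G → ZMod 2))) ∧
    (∃ S : AddSubgroup (G → ZMod 2),
      ↑S = ({fun _ => 0, fun _ => 1} : Set (G → ZMod 2))) ∧
    ¬ IsSFT (ZMod 2) ({fun _ => 0, fun _ => 1} : Set (G → ZMod 2)) := by
  refine ⟨?_, ?_, ?_, not_isSFT_pair_const hG zero_ne_one⟩
  · let : TopologicalSpace (ZMod 2) := ⊥
    have : DiscreteTopology (ZMod 2) := ⟨rfl⟩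
    exact (Set.toFinite ({fun _ => 0, fun _ => 1} : Set (G → ZMod 2))).isClosed
  · rintro g x (rfl | rfl)
    · exact Or.inl rfl
    · exact Or.inr rfl
  · refine ⟨(Pi.constAddMonoidHom G (ZMod 2)).range, Set.ext fun x => ⟨?_, ?_⟩⟩
    · rintro ⟨c, rfl⟩
      fin_cases c
      · exact Or.inl rfl
      · exact Or.inr rfl
    · rintro (rfl | rfl)
      · exact ⟨0, rfl⟩
      · exact ⟨1, rfl⟩
end

section
/- Let G be a group, H a subgroup of G, Σ a finite discrete set, and Y ⊆ (H → Σ) a subshift (closed and H-shift-invariant). If Y is of finite type as an H-subshift, then the coset extension X = Y^{G/H} = {x : G → Σ | for all g ∈ G, the function h ↦ x(g⁻¹h) lies in Y} is of finite type as a G-subshift. -/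
/-- The coset extension `Y^{G/H}` of a set `Y ⊆ A^H` to `A^G`. -/
def cosetExt {G : Type*} [Group G] (H : Subgroup G) {A : Type*} (Y : Set (↥H → A)) :
    Set (G → A) :=
  {x : G → A | ∀ g : G, (fun h : ↥H => x (g⁻¹ * (h : G))) ∈ Y}

/-- Restriction of configurations along a map of index sets is continuous. -/
theorem continuous_prodTop_comp {I J A : Type*} (f : I → J) :
    @Continuous _ _ (prodTop J A) (prodTop I A) fun x i => x (f i) := by
  let _ : TopologicalSpace A := ⊥
  exact continuous_pi fun i => continuous_apply (f i)

theorem shift_one {G A : Type*} [Group G] (x : G → A) : shift 1 x = x := by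
  funext k
  simp [shift]

/-- Restriction to a subgroup intertwines the shift actions. -/
theorem shift_restrict_shift {G A : Type*} [Group G] (H : Subgroup G) (h : H) (g : G)
    (x : G → A) :
    shift h (fun k : H => shift g x k) = fun k : H => shift ((h : G) * g) x k := by
  funext k
  simp [shift, mul_assoc]

/-- If the `H`-subshift `Y` is of finite type, then so is its coset extension. -/
theorem stmt_4 {G : Type*} [Group G] (H : Subgroup G) (A : Type*) [Finite A]
    (Y : Set (↥H → A))
    (hYclosed : @IsClosed _ (prodTop ↥H A) Y)
    (hYinv : ∀ (h : ↥H) (y : ↥H → A), y ∈ Y → shift h y ∈ Y)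
    (hYsft : IsSFT A Y) :
    IsSFT A (cosetExt H Y) := by
  obtain ⟨C, hC, hY⟩ := hYsft
  refine ⟨(fun x (k : H) => x k) ⁻¹' C,
    @IsClopen.preimage _ _ (prodTop G A) (prodTop H A) _ hC _
      (continuous_prodTop_comp _), fun x => ⟨fun hx g => ?_, fun hx g => ?_⟩⟩
  · have h := (hY _).1 (hx g) 1
    rw [shift_one] at h
    exact h
  · refine (hY _).2 fun h => ?_
    exact (shift_restrict_shift H h g x).symm ▸ hx ((h : G) * g)
end

section
/- Let G be a group, H a subgroup of G, Σ a finite discrete set, and Y ⊆ (H → Σ) a subshift (closed and H-shift-invariant). If the coset extension X = Y^{G/H} = {x : G → Σ | for all g ∈ G, the function h ↦ x(g⁻¹h) lies in Y} is of finite type as a G-subshift, then Y is of finite type as an H-subshift. Moreover, if X is defined by a clopen set with finite support A ⊆ G, then Y is defined by a clopen set with support A⁻¹A ∩ H. -/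
open Pointwise

/-- A set of configurations that depends on finitely many coordinates is clopen. -/
theorem isClopen_prodTop_of_finite_support {I A : Type*} {F : Set I} (hF : F.Finite)
    {D : Set (I → A)} (hD : ∀ y y' : I → A, (∀ i ∈ F, y i = y' i) → (y ∈ D ↔ y' ∈ D)) :
    @IsClopen _ (prodTop I A) D := by
  let _ : TopologicalSpace A := ⊥
  have : DiscreteTopology A := ⟨rfl⟩
  have : Finite F := hF
  have hpre : D = F.domRestrict ⁻¹' (F.domRestrict '' D) := by
    refine (Set.subset_preimage_image _ _).antisymm ?_
    rintro y ⟨y', hy', hyy'⟩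
    exact (hD y' y fun i hi => congrFun hyy' ⟨i, hi⟩).1 hy'
  have hcont : Continuous (F.domRestrict : (I → A) → F → A) :=
    continuous_pi fun i => continuous_apply i.1
  change IsClopen D
  rw [hpre]
  exact (isClopen_discrete _).preimage hcont

/-- The configuration on `G` whose restriction to each left coset `c` of `H`, read off from the
representative `c.out`, is `z c`. -/
noncomputable def cosetGlue {G : Type*} [Group G] (H : Subgroup G) {A : Type*}
    (z : G ⧸ H → H → A) : G → A :=
  fun g => z g ⟨(g : G ⧸ H).out⁻¹ * g, QuotientGroup.eq.1 (QuotientGroup.out_eq' _)⟩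

theorem cosetGlue_out_mul {G : Type*} [Group G] (H : Subgroup G) {A : Type*}
    (z : G ⧸ H → H → A) (c : G ⧸ H) (h : H) : cosetGlue H z (c.out * h) = z c h := by
  have hc : ((c.out * h : G) : G ⧸ H) = c := by
    rw [QuotientGroup.mk_mul_of_mem _ h.2, QuotientGroup.out_eq']
  unfold cosetGlue
  simp [hc]

theorem exists_eq_out_mul {G : Type*} [Group G] (H : Subgroup G) (g : G) :
    ∃ h : H, g = (g : G ⧸ H).out * h :=
  ⟨⟨(g : G ⧸ H).out⁻¹ * g, QuotientGroup.eq.1 (QuotientGroup.out_eq' _)⟩, by simp⟩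

theorem cosetGlue_mem_cosetExt {G : Type*} [Group G] (H : Subgroup G) {A : Type*}
    {Y : Set (H → A)} (hY : ∀ (h : H) (y : H → A), y ∈ Y → shift h y ∈ Y)
    {z : G ⧸ H → H → A} (hz : ∀ c, z c ∈ Y) : cosetGlue H z ∈ cosetExt H Y := by
  intro g
  obtain ⟨k, hk⟩ := exists_eq_out_mul H g⁻¹
  convert hY k⁻¹ _ (hz (g⁻¹ : G)) using 1
  funext h
  rw [hk, mul_assoc, ← Subgroup.coe_mul, ← hk, cosetGlue_out_mul, shift, inv_inv]

/-- If the coset extension `Y^{G/H}` is of finite type, defined by a clopen set `C`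
with finite support `S ⊆ G`, then `Y` is of finite type, defined by a clopen set
with support `S⁻¹S ∩ H`. -/
theorem stmt_5 {G : Type*} [Group G] (H : Subgroup G) (A : Type*) [Finite A]
    (Y : Set (↥H → A))
    (hYclosed : @IsClosed _ (prodTop ↥H A) Y)
    (hYinv : ∀ (h : ↥H) (y : ↥H → A), y ∈ Y → shift h y ∈ Y)
    (C : Set (G → A)) (hC : @IsClopen _ (prodTop G A) C)
    (S : Finset G)
    (hsupp : ∀ x y : G → A, (∀ a ∈ S, x a = y a) → (x ∈ C ↔ y ∈ C))
    (hdef : ∀ x : G → A, x ∈ cosetExt H Y ↔ ∀ g : G, shift g x ∈ C) :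
    ∃ D : Set (↥H → A),
      @IsClopen _ (prodTop ↥H A) D ∧
      (∀ y y' : ↥H → A,
        (∀ h : ↥H, (h : G) ∈ (S : Set G)⁻¹ * (S : Set G) → y h = y' h) →
        (y ∈ D ↔ y' ∈ D)) ∧
      (∀ y : ↥H → A, y ∈ Y ↔ ∀ h : ↥H, shift h y ∈ D) := by
  let D : Set (H → A) := {y | Y.Nonempty ∧ ∀ s ∈ S, ∃ z ∈ Y, ∀ h : H,
    (∃ t ∈ S, (h : G) = s⁻¹ * t) → z h = y h}
  have hDsupp : ∀ y y' : H → A,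
      (∀ h : H, (h : G) ∈ (S : Set G)⁻¹ * (S : Set G) → y h = y' h) → y ∈ D → y' ∈ D := by
    rintro y y' hyy' ⟨hne, hy⟩
    refine ⟨hne, fun s hs => ?_⟩
    obtain ⟨z, hz, hzy⟩ := hy s hs
    refine ⟨z, hz, fun h hh => (hzy h hh).trans (hyy' h ?_)⟩
    obtain ⟨t, ht, hst⟩ := hh
    rw [hst]
    exact Set.mul_mem_mul (Set.inv_mem_inv.2 hs) ht
  have hDiff : ∀ y y' : H → A,
      (∀ h : H, (h : G) ∈ (S : Set G)⁻¹ * (S : Set G) → y h = y' h) → (y ∈ D ↔ y' ∈ D) :=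
    fun y y' h => ⟨hDsupp y y' h, hDsupp y' y fun k hk => (h k hk).symm⟩
  refine ⟨D, isClopen_prodTop_of_finite_support
    (F := ((↑) : H → G) ⁻¹' ((S : Set G)⁻¹ * (S : Set G)))
    ((S.finite_toSet.inv.mul S.finite_toSet).preimage Subtype.val_injective.injOn) hDiff,
    hDiff, fun y => ⟨fun hy h => ⟨⟨y, hy⟩, fun s _ => ⟨_, hYinv h y hy, fun _ _ => rfl⟩⟩,
    fun hy => ?_⟩⟩
  obtain ⟨y₀, hy₀⟩ := (hy 1).1
  have hx : cosetGlue H (fun _ => y) ∈ cosetExt H Y := by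
    refine (hdef _).2 fun g => ?_
    have key : ∀ c : G ⧸ H, ∃ z ∈ Y, ∀ h : H, (∃ t ∈ S, g⁻¹ * t = c.out * h) → z h = y h := by
      intro c
      by_cases hc : ∃ s ∈ S, ∃ k : H, g⁻¹ * s = c.out * k
      · obtain ⟨s, hs, k, hk⟩ := hc
        obtain ⟨z, hz, hzy⟩ := (hy k⁻¹).2 s hs
        refine ⟨shift k z, hYinv k z hz, ?_⟩
        rintro h ⟨t, ht, hth⟩
        have hst : ((k⁻¹ * h : H) : G) = s⁻¹ * t := by
          have hs' : s = g * (c.out * k) := by rw [← hk]; group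
          have ht' : t = g * (c.out * h) := by rw [← hth]; group
          rw [hs', ht', Subgroup.coe_mul, Subgroup.coe_inv]
          group
        simpa [shift] using hzy (k⁻¹ * h) ⟨t, ht, hst⟩
      · refine ⟨y₀, hy₀, ?_⟩
        rintro h ⟨t, ht, hth⟩
        exact absurd ⟨t, ht, h, hth⟩ hc
    choose z hz hzy using key
    refine (hsupp _ _ fun s hs => ?_).1 ((hdef _).1 (cosetGlue_mem_cosetExt H hYinv hz) g)
    obtain ⟨k, hk⟩ := exists_eq_out_mul H (g⁻¹ * s)
    rw [shift, shift, hk, cosetGlue_out_mul, cosetGlue_out_mul]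
    exact hzy _ k ⟨s, hs, hk⟩
  simpa [cosetGlue_out_mul] using hx (((1 : G) : G ⧸ H).out)⁻¹
end

section
/- Let G and H be nontrivial groups such that it is not the case that both G and H have exactly two elements (i.e., ¬(Nat.card G = 2 ∧ Nat.card H = 2)). Then the free product G ∗ H does not satisfy the maximal condition on subgroups; that is, there exists a subgroup of G ∗ H that is not finitely generated. -/
open Monoid

namespace Monoid.CoprodI

theorem NeWord.prod_ne_one {ι : Type*} {M : ι → Type*} [∀ i, Monoid (M i)] {i j : ι}
    (w : NeWord M i j) : w.prod ≠ 1 := by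
  classical
  intro h
  have h' : w.toWord = Word.empty :=
    Word.equiv.symm.injective (h.trans Word.prod_empty.symm)
  exact w.toList_ne_nil (congrArg Word.toList h')

/-- A free product of infinitely many nontrivial groups is not finitely generated. -/
theorem not_fg_of_infinite {ι : Type*} [Infinite ι] {M : ι → Type*} [∀ i, Group (M i)]
    [∀ i, Nontrivial (M i)] : ¬ Group.FG (CoprodI M) := by
  classical
  let π (i : ι) : CoprodI M →* M i := lift (Pi.mulSingle i (MonoidHom.id (M i)))
  have hπ (x : CoprodI M) : {i | π i x ≠ 1}.Finite := by
    induction x using CoprodI.induction_on with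
    | one => simp
    | of j m =>
      refine (Set.finite_singleton j).subset fun i hi => ?_
      by_contra hij
      exact hi (by simp [π, Pi.mulSingle_eq_of_ne (Ne.symm hij)])
    | mul x y hx hy =>
      refine (hx.union hy).subset fun i hi => ?_
      by_contra h
      simp only [Set.mem_union, Set.mem_ofPred_eq, not_or, not_not] at h
      exact hi (by rw [map_mul, h.1, h.2, one_mul])
  intro ⟨S, hS⟩
  obtain ⟨i, hi⟩ := (S.finite_toSet.biUnion fun x _ => hπ x).exists_notMem
  obtain ⟨m, hm⟩ := exists_ne (1 : M i)
  have hker : Subgroup.closure (S : Set (CoprodI M)) ≤ (π i).ker := by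
    rw [Subgroup.closure_le]
    intro x hx
    by_contra h
    exact hi (Set.mem_biUnion hx h)
  have h1 : π i (of m) = 1 := hker (hS ▸ Subgroup.mem_top _)
  exact hm (by simpa [π] using h1)

section

variable {ι : Type*} {M : ι → Type*} [∀ i, Group (M i)] {i j : ι}

theorem exists_neWord_mul_pow_mul (hij : i ≠ j) {g : M i} {h k : M j} (hg : g ≠ 1) (hh : h ≠ 1)
    (hk : k ≠ 1) (n : ℕ) :
    ∃ w : NeWord M i j, w.prod = of g * (of h * of g) ^ n * of k := by
  induction n with
  | zero => exact ⟨(NeWord.singleton g hg).append hij (NeWord.singleton k hk), by simp⟩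
  | succ n ih =>
    obtain ⟨w, hw⟩ := ih
    exact ⟨((NeWord.singleton g hg).append hij (NeWord.singleton h hh)).append hij.symm w,
      by simp [hw, pow_succ', mul_assoc]⟩

theorem exists_neWord_conj_pow (hij : i ≠ j) {g : M i} {h k : M j} (hg : g ≠ 1) (hh : h ≠ 1)
    (hk : k ≠ 1) (hhk : h ≠ k) {m n : ℕ} (hmn : m ≠ n) :
    ∃ w : NeWord M j j,
      w.prod = ((of h * of g) ^ m * of k)⁻¹ * ((of h * of g) ^ n * of k) := by
  wlog hlt : m < n generalizing m n
  · obtain ⟨w, hw⟩ := this hmn.symm (by omega)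
    exact ⟨w.inv, by rw [NeWord.inv_prod, hw]; group⟩
  obtain ⟨d, rfl⟩ := Nat.exists_eq_add_of_lt hlt
  obtain ⟨w, hw⟩ := exists_neWord_mul_pow_mul hij hg hh hk d
  refine ⟨(NeWord.singleton (k⁻¹ * h) (by rwa [Ne, inv_mul_eq_one, eq_comm])).append hij.symm w, ?_⟩
  rw [add_assoc, pow_add, pow_succ']
  simp [hw, mul_assoc]

/-- The conjugates of a free factor by elements `c n` generate their free product as soon as all
the quotients `(c m)⁻¹ * c n` are reduced words beginning and ending in another factor. -/
theorem lift_conj_injective {κ : Type*} [Nontrivial κ] (hij : i ≠ j) (c : κ → CoprodI M)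
    (hc : ∀ m n, m ≠ n → ∃ w : NeWord M j j, w.prod = (c m)⁻¹ * c n) :
    Function.Injective
      (lift fun n : κ => (MulAut.conj (c n)).toMonoidHom.comp (of : M i →* CoprodI M)) := by
  classical
  set F := lift fun n : κ => (MulAut.conj (c n)).toMonoidHom.comp (of : M i →* CoprodI M) with hF
  have key {m n : κ} (w : NeWord (fun _ : κ => M i) m n) :
      ∃ u : NeWord M i i, F w.prod = c m * u.prod * (c n)⁻¹ := by
    induction w with
    | singleton x hx => exact ⟨NeWord.singleton x hx, by simp [hF]⟩
    | append w₁ hne w₂ ih₁ ih₂ =>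
      obtain ⟨u₁, hu₁⟩ := ih₁
      obtain ⟨u₂, hu₂⟩ := ih₂
      obtain ⟨v, hv⟩ := hc _ _ hne
      exact ⟨(u₁.append hij v).append hij.symm u₂, by simp [hu₁, hu₂, hv, mul_assoc]⟩
  rw [injective_iff_map_eq_one]
  intro x hx
  by_contra hx1
  obtain ⟨m, n, w, hw⟩ := NeWord.of_word (Word.equiv x) fun h =>
    hx1 (Word.equiv.injective (h.trans (Word.equiv.apply_symm_apply Word.empty).symm))
  have hwx : w.prod = x := (congrArg Word.prod hw).trans (Word.equiv.symm_apply_apply x)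
  obtain ⟨u, hu⟩ := key w
  rw [hwx, hx] at hu
  by_cases hmn : m = n
  · subst hmn
    exact u.prod_ne_one (conj_eq_one_iff.mp hu.symm)
  · obtain ⟨v, hv⟩ := hc n m (Ne.symm hmn)
    apply (u.append hij v).prod_ne_one
    rw [NeWord.append_prod, hv, ← mul_assoc, mul_eq_one_iff_eq_inv, ← mul_right_inj (c m),
      ← mul_assoc, ← hu, mul_inv_cancel]

theorem exists_subgroup_not_fg (hij : i ≠ j) [Nontrivial (M i)] [Nontrivial (M j)]
    (hcard : Nat.card (M j) ≠ 2) : ∃ K : Subgroup (CoprodI M), ¬ K.FG := by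
  obtain ⟨g, hg⟩ := exists_ne (1 : M i)
  obtain ⟨h, hh⟩ := exists_ne (1 : M j)
  obtain ⟨k, hk, hhk⟩ : ∃ k : M j, k ≠ 1 ∧ h ≠ k := by
    by_contra! hall
    refine hcard (Nat.card_eq_two_iff.mpr ⟨1, h, hh.symm, Set.eq_univ_of_forall fun x => ?_⟩)
    by_cases hx : x = 1
    · exact Or.inl hx
    · exact Or.inr (hall x hx).symm
  obtain ⟨F, hF⟩ : ∃ F : CoprodI (fun _ : ℕ => M i) →* CoprodI M, Function.Injective F :=
    ⟨_, lift_conj_injective hij (fun n : ℕ => (of h * of g) ^ n * of k)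
      fun _ _ => exists_neWord_conj_pow hij hg hh hk hhk⟩
  refine ⟨F.range, fun hK => not_fg_of_infinite (M := fun _ : ℕ => M i) ?_⟩
  have := (Group.fg_iff_subgroup_fg _).mpr hK
  let e := MonoidHom.ofInjective hF
  exact Group.fg_of_surjective (f := e.symm.toMonoidHom) e.symm.surjective

end

end Monoid.CoprodI

theorem Subgroup.exists_not_fg_of_surjective {G H : Type*} [Group G] [Group H] {f : G →* H}
    (hf : Function.Surjective f) (h : ∃ K : Subgroup H, ¬ K.FG) : ∃ K : Subgroup G, ¬ K.FG := by
  obtain ⟨K, hK⟩ := h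
  refine ⟨K.comap f, fun hfg => hK ((Group.fg_iff_subgroup_fg K).mp ?_)⟩
  have := (Group.fg_iff_subgroup_fg _).mpr hfg
  exact Group.fg_of_surjective (f.subgroupComap_surjective_of_surjective K hf)

universe u v

/-- The groups `G` and `H`, lifted to a common universe, as a family indexed by `Bool`. -/
def BoolFamily (G : Type u) (H : Type v) : Bool → Type (max u v)
  | true => ULift.{v} G
  | false => ULift.{u} H

instance (G H : Type*) [Group G] [Group H] : ∀ b, Group (BoolFamily G H b)
  | true => inferInstanceAs (Group (ULift G))
  | false => inferInstanceAs (Group (ULift H))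

/-- A free product of nontrivial groups, not both of order two, has a subgroup that
is not finitely generated (i.e. fails the maximal condition on subgroups). -/
theorem stmt_10 {G H : Type*} [Group G] [Group H] [Nontrivial G] [Nontrivial H]
    (hcard : ¬ (Nat.card G = 2 ∧ Nat.card H = 2)) :
    ∃ K : Subgroup (Monoid.Coprod G H), ¬ K.FG := by
  let eG : BoolFamily G H true ≃* G := MulEquiv.ulift
  let eH : BoolFamily G H false ≃* H := MulEquiv.ulift
  have := eG.toEquiv.nontrivial
  have := eH.toEquiv.nontrivial
  let f : Monoid.Coprod G H →* CoprodI (BoolFamily G H) :=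
    Coprod.lift (CoprodI.of.comp eG.symm.toMonoidHom) (CoprodI.of.comp eH.symm.toMonoidHom)
  have hf : Function.Surjective f := by
    intro x
    induction x using CoprodI.induction_on with
    | one => exact ⟨1, map_one f⟩
    | of b m =>
      cases b with
      | true => exact ⟨Coprod.inl (eG m), by simp [f]⟩
      | false => exact ⟨Coprod.inr (eH m), by simp [f]⟩
    | mul x y hx hy =>
      obtain ⟨a, rfl⟩ := hx
      obtain ⟨b, rfl⟩ := hy
      exact ⟨a * b, map_mul f a b⟩
  apply Subgroup.exists_not_fg_of_surjective hf
  by_cases hH : Nat.card H = 2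
  · have hG : Nat.card (BoolFamily G H true) ≠ 2 := by
      rw [Nat.card_congr eG.toEquiv]
      exact fun hG => hcard ⟨hG, hH⟩
    exact CoprodI.exists_subgroup_not_fg (i := false) (by decide) hG
  · rw [← Nat.card_congr eH.toEquiv] at hH
    exact CoprodI.exists_subgroup_not_fg (i := true) (by decide) hH
end

section
/- Let G be an uncountable group (its underlying type is not countable). Then there exists a set X ⊆ (G → ZMod 2) which is closed in the product topology, invariant under the shift action of G, and a subgroup of the product group (G → ZMod 2) under pointwise addition, but which is not of finite type: there is no clopen set C ⊆ (G → ZMod 2) such that for all x, x ∈ X if and only if g • x ∈ C for all g ∈ G. -/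
/-- An open set containing a configuration `a` contains every configuration agreeing with `a`
on a suitable finite set of coordinates. -/
lemma exists_finset_of_isOpen_prodTop {G A : Type*} {C : Set (G → A)}
    (hC : @IsOpen _ (prodTop G A) C) {a : G → A} (ha : a ∈ C) :
    ∃ F : Finset G, ∀ y : G → A, (∀ i ∈ F, y i = a i) → y ∈ C := by
  obtain ⟨F, u, hu, hsub⟩ := (@isOpen_pi_iff G (fun _ => A) (fun _ => ⊥) C).1 hC a ha
  refine ⟨F, fun y hy => hsub fun i hi => ?_⟩
  rw [hy i hi]
  exact (hu i hi).2

/-- The constant configurations form a closed set. -/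
lemma isClosed_prodTop_constant (G A : Type*) :
    @IsClosed _ (prodTop G A) {x : G → A | ∀ a b, x a = x b} := by
  let : TopologicalSpace A := ⊥
  have : DiscreteTopology A := ⟨rfl⟩
  change IsClosed {x : G → A | ∀ a b, x a = x b}
  simp only [Set.ofPred_forall]
  exact isClosed_iInter fun a => isClosed_iInter fun b =>
    isClosed_eq (continuous_apply a) (continuous_apply b)

/-- A finite subset of an uncountable group generates a proper subgroup. -/
lemma exists_notMem_closure_of_not_countable {G : Type*} [Group G] (hG : ¬ Countable G)
    (F : Finset G) : ∃ g : G, g ∉ Subgroup.closure (F : Set G) := by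
  by_contra! h
  have : Countable (FreeGroup F) := Quot.mk_surjective.countable
  have hsurj : Function.Surjective (FreeGroup.lift ((↑) : F → G)) := by
    rw [← MonoidHom.range_eq_top, FreeGroup.range_lift_eq_closure, Subgroup.eq_top_iff']
    simpa using h
  exact hG hsurj.countable

/-- The constant configurations over an uncountable group are not of finite type. -/
lemma not_isSFT_constant {G : Type*} [Group G] (hG : ¬ Countable G) :
    ¬ IsSFT (ZMod 2) {x : G → ZMod 2 | ∀ a b, x a = x b} := by
  classical
  rintro ⟨C, hC, hX⟩
  have hconst (c : ZMod 2) : (fun _ : G => c) ∈ C := (hX fun _ => c).1 (fun _ _ => rfl) 1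
  obtain ⟨F₀, h₀⟩ := exists_finset_of_isOpen_prodTop hC.2 (hconst 0)
  obtain ⟨F₁, h₁⟩ := exists_finset_of_isOpen_prodTop hC.2 (hconst 1)
  obtain ⟨k, hk⟩ := exists_notMem_closure_of_not_countable hG (F₀ ∪ F₁)
  set H := Subgroup.closure ((F₀ ∪ F₁ : Finset G) : Set G) with hH
  have hF : ∀ i ∈ F₀ ∪ F₁, i ∈ H := fun i hi => Subgroup.subset_closure hi
  have hx : (fun h : G => if h ∈ H then (1 : ZMod 2) else 0) ∈
      {x : G → ZMod 2 | ∀ a b, x a = x b} := by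
    refine (hX _).2 fun g => ?_
    by_cases hg : g⁻¹ ∈ H
    · refine h₁ _ fun i hi => if_pos ?_
      exact H.mul_mem hg (hF i (Finset.mem_union_right _ hi))
    · refine h₀ _ fun i hi => if_neg ?_
      rwa [H.mul_mem_cancel_right (hF i (Finset.mem_union_left _ hi))]
  have := hx 1 k
  simp [H.one_mem, hk] at this

/-- Every uncountable group carries an abelian group shift over `ZMod 2`
which is not of finite type. -/
theorem stmt_13 {G : Type*} [Group G] (hG : ¬ Countable G) :
    ∃ X : Set (G → ZMod 2),
      @IsClosed _ (prodTop G (ZMod 2)) X ∧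
      (∀ (g : G) (x : G → ZMod 2), x ∈ X → shift g x ∈ X) ∧
      (∃ S : AddSubgroup (G → ZMod 2), ↑S = X) ∧
      ¬ IsSFT (ZMod 2) X := by
  refine ⟨{x | ∀ a b, x a = x b}, isClosed_prodTop_constant G _,
    fun g x hx a b => hx _ _, ⟨⟨⟨⟨_, ?_⟩, ?_⟩, ?_⟩, rfl⟩, not_isSFT_constant hG⟩
  · intro x y hx hy a b
    simp only [Pi.add_apply, hx a b, hy a b]
  · exact fun _ _ => rfl
  · intro x hx a b
    simp only [Pi.neg_apply, hx a b]
end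

section
/- Let G be a virtually solvable group, i.e., G has a solvable subgroup of finite index. Then every subgroup of G is finitely generated (equivalently, G satisfies the maximal condition on subgroups) if and only if G is virtually polycyclic, i.e., G has a polycyclic subgroup of finite index. -/
/-- A group is polycyclic if it has a finite subnormal chain `⊥ = G₀ ≤ ⋯ ≤ Gₙ = ⊤`
with each `Gᵢ` normal in `Gᵢ₊₁` and each quotient `Gᵢ₊₁/Gᵢ` cyclic. -/
def IsPolycyclic (G : Type*) [Group G] : Prop :=
  ∃ (n : ℕ) (s : Fin (n + 1) → Subgroup G),
    s 0 = ⊥ ∧ s (Fin.last n) = ⊤ ∧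
    ∀ i : Fin n,
      s i.castSucc ≤ s i.succ ∧
      ∃ hn : ((s i.castSucc).subgroupOf (s i.succ)).Normal,
        letI := hn
        IsCyclic ((s i.succ) ⧸ (s i.castSucc).subgroupOf (s i.succ))

/-- `A` is a normal subgroup of `B` with cyclic quotient. -/
def Subgroup.IsCyclicStep {G : Type*} [Group G] (A B : Subgroup G) : Prop :=
  A ≤ B ∧ ∃ hn : (A.subgroupOf B).Normal,
    letI := hn
    IsCyclic (B ⧸ A.subgroupOf B)

namespace Subgroup

variable {G : Type*} [Group G]

theorem isCyclicStep_sup_zpowers {C : Subgroup G} {x : G} (hx : x ∈ normalizer (C : Set G)) :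
    C.IsCyclicStep (C ⊔ zpowers x) := by
  have hle : C ≤ C ⊔ zpowers x := le_sup_left
  have hn : (C.subgroupOf (C ⊔ zpowers x)).Normal :=
    (normal_subgroupOf_iff_le_normalizer hle).2
      (sup_le le_normalizer ((zpowers_le).2 hx))
  refine ⟨hle, hn, ?_⟩
  have hxD : x ∈ C ⊔ zpowers x := le_sup_right (a := C) (mem_zpowers x)
  let q := QuotientGroup.mk' (C.subgroupOf (C ⊔ zpowers x))
  let E := ((zpowers (q ⟨x, hxD⟩)).comap q).map (C ⊔ zpowers x).subtype
  have hE : C ⊔ zpowers x ≤ E := by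
    refine sup_le (fun c hc ↦ ?_) ((zpowers_le).2 ?_)
    · refine ⟨⟨c, hle hc⟩, ?_, rfl⟩
      have : q ⟨c, hle hc⟩ = 1 := (QuotientGroup.eq_one_iff _).2 hc
      rw [SetLike.mem_coe, mem_comap, this]
      exact one_mem _
    · exact ⟨⟨x, hxD⟩, mem_zpowers _, rfl⟩
  refine ⟨q ⟨x, hxD⟩, fun y ↦ ?_⟩
  obtain ⟨d, rfl⟩ := QuotientGroup.mk'_surjective _ y
  obtain ⟨e, he, hed⟩ := hE d.2
  obtain rfl : e = d := Subtype.ext hed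
  exact he

theorem reflTransGen_isCyclicStep_of_commutator_le {A B : Subgroup G} (hAB : A ≤ B)
    (hB : B.FG) (hc : ⁅B, B⁆ ≤ A) : Relation.ReflTransGen IsCyclicStep A B := by
  classical
  obtain ⟨S, rfl⟩ := hB
  have key : ∀ T : Finset G, T ⊆ S →
      Relation.ReflTransGen IsCyclicStep A (A ⊔ closure (T : Set G)) := by
    intro T
    induction T using Finset.induction_on with
    | empty => intro _; simpa using Relation.ReflTransGen.refl
    | insert x T _ ih =>
      intro hT
      rw [Finset.insert_subset_iff] at hT
      refine (ih hT.2).tail ?_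
      rw [Finset.coe_insert, Set.insert_eq, closure_union, ← zpowers_eq_closure,
        sup_comm (zpowers x), ← sup_assoc]
      apply isCyclicStep_sup_zpowers
      have hle : A ⊔ closure (T : Set G) ≤ closure (S : Set G) :=
        sup_le hAB (closure_mono (by exact_mod_cast hT.2))
      refine (normal_subgroupOf_iff_le_normalizer hle).1
        ((normal_subgroupOf_iff hle).2 fun h k hh hk ↦ ?_)
        (subset_closure (Finset.mem_coe.2 hT.1))
      have hcomm : k * h * k⁻¹ * h⁻¹ ∈ A ⊔ closure (T : Set G) :=
        le_sup_left (a := A) (hc (commutator_mem_commutator hk (hle hh)))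
      simpa using mul_mem hcomm hh
  simpa [sup_eq_right.2 hAB] using key S subset_rfl

theorem FG.of_inf_of_isCyclicStep {A B K : Subgroup G} (hAB : A.IsCyclicStep B) (hKB : K ≤ B)
    (hK : (K ⊓ A).FG) : K.FG := by
  obtain ⟨-, hn, hcyc⟩ := hAB
  let f := (QuotientGroup.mk' (A.subgroupOf B)).comp (inclusion hKB)
  obtain ⟨⟨_, k, rfl⟩, hk⟩ := (inferInstance : IsCyclic f.range).exists_generator
  suffices K = (K ⊓ A) ⊔ zpowers (k : G) by
    rw [this]
    exact hK.sup ⟨{(k : G)}, by rw [Finset.coe_singleton, zpowers_eq_closure]⟩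
  refine le_antisymm (fun g hg ↦ ?_) (sup_le inf_le_left ((zpowers_le).2 k.2))
  obtain ⟨m, hm⟩ := hk ⟨f ⟨g, hg⟩, ⟨g, hg⟩, rfl⟩
  have hm' : f k ^ m = f ⟨g, hg⟩ := congrArg Subtype.val hm
  have h1 : f (⟨g, hg⟩ * (k ^ m)⁻¹) = 1 := by rw [map_mul, map_inv, map_zpow, hm', mul_inv_cancel]
  have h2 : g * ((k : G) ^ m)⁻¹ ∈ A :=
    (QuotientGroup.eq_one_iff (N := A.subgroupOf B)
      (inclusion hKB ((⟨g, hg⟩ : K) * (k ^ m)⁻¹))).1 h1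
  rw [← inv_mul_cancel_right g ((k : G) ^ m)]
  exact mul_mem (mem_sup_left ⟨K.mul_mem hg (K.inv_mem (K.zpow_mem k.2 m)), h2⟩)
    (mem_sup_right (zpow_mem (mem_zpowers _) m))

theorem _root_.Group.FG.of_finiteIndex {H : Subgroup G} [H.FiniteIndex] (hH : H.FG) :
    Group.FG G := by
  have : Finite (G ⧸ H) := finite_quotient_of_finiteIndex
  have : Finite (Set.range (Quotient.out : G ⧸ H → G)) :=
    Finite.of_surjective _ (Set.rangeFactorization_surjective (f := (Quotient.out : G ⧸ H → G)))
  have hT : (closure (Set.range (Quotient.out : G ⧸ H → G))).FG :=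
    (Group.fg_iff_subgroup_fg _).1 inferInstance
  have htop : H ⊔ closure (Set.range (Quotient.out : G ⧸ H → G)) = ⊤ := by
    refine eq_top_iff.2 fun g _ ↦ ?_
    obtain ⟨h, hh⟩ := QuotientGroup.mk_out_eq_mul H g
    rw [← mul_inv_cancel_right g (h : G), ← hh]
    exact mul_mem (mem_sup_right (subset_closure ⟨_, rfl⟩)) (mem_sup_left (inv_mem h.2))
  exact Group.fg_def.2 (htop ▸ hH.sup hT)

theorem FG.of_inf_of_finiteIndex {H K : Subgroup G} [H.FiniteIndex] (h : (K ⊓ H).FG) : K.FG := by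
  rw [← Group.fg_iff_subgroup_fg] at h ⊢
  have hfg : Group.FG (H.subgroupOf K) := by
    rw [← inf_subgroupOf_left]
    exact Group.fg_of_surjective
      (f := (subgroupOfEquivOfLe (inf_le_left : K ⊓ H ≤ K)).symm.toMonoidHom)
      (subgroupOfEquivOfLe _).symm.surjective
  exact Group.FG.of_finiteIndex ((Group.fg_iff_subgroup_fg (H.subgroupOf K)).1 hfg)

end Subgroup

theorem isPolycyclic_of_reflTransGen {G : Type*} [Group G]
    (h : Relation.ReflTransGen Subgroup.IsCyclicStep (⊥ : Subgroup G) ⊤) : IsPolycyclic G := by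
  suffices ∀ B : Subgroup G, Relation.ReflTransGen Subgroup.IsCyclicStep ⊥ B →
      ∃ (n : ℕ) (s : Fin (n + 1) → Subgroup G), s 0 = ⊥ ∧ s (Fin.last n) = B ∧
        ∀ i : Fin n, (s i.castSucc).IsCyclicStep (s i.succ) from this ⊤ h
  intro B hB
  induction hB with
  | refl => exact ⟨0, fun _ ↦ ⊥, rfl, rfl, fun i ↦ i.elim0⟩
  | @tail B C _ hBC ih =>
    obtain ⟨n, s, h0, hl, hs⟩ := ih
    refine ⟨n + 1, Fin.snoc s C, ?_, by simp, fun i ↦ ?_⟩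
    · rw [← Fin.castSucc_zero, Fin.snoc_castSucc, h0]
    · induction i using Fin.lastCases with
      | last => simpa [hl] using hBC
      | cast i =>
        rw [Fin.succ_castSucc, Fin.snoc_castSucc, Fin.snoc_castSucc]
        exact hs i

theorem isPolycyclic_of_isSolvable_of_fg {G : Type*} [Group G] [Group.IsSolvable G]
    (hG : ∀ K : Subgroup G, K.FG) : IsPolycyclic G := by
  obtain ⟨n, hn⟩ := Group.IsSolvable.solvable (G := G)
  apply isPolycyclic_of_reflTransGen
  rw [← hn]
  clear hn
  induction n with
  | zero => exact .refl
  | succ n ih =>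
    exact (Subgroup.reflTransGen_isCyclicStep_of_commutator_le
      (derivedSeries_antitone G n.le_succ) (hG _) (derivedSeries_succ G n).ge).trans ih

theorem IsPolycyclic.fg_subgroup {G : Type*} [Group G] (hG : IsPolycyclic G) (K : Subgroup G) :
    K.FG := by
  obtain ⟨n, s, h0, hl, hs⟩ := hG
  have key : ∀ i, (K ⊓ s i).FG := by
    intro i
    induction i using Fin.induction with
    | zero => simpa [h0] using Subgroup.FG.bot
    | succ i ih =>
      refine .of_inf_of_isCyclicStep (hs i) inf_le_right ?_
      rwa [inf_assoc, inf_eq_right.2 (hs i).1]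
  simpa [hl] using key (Fin.last n)

/-- A virtually solvable group satisfies the maximal condition on subgroups
(every subgroup is finitely generated) iff it is virtually polycyclic. -/
theorem stmt_15 {G : Type*} [Group G]
    (hvs : ∃ H : Subgroup G, H.FiniteIndex ∧ IsSolvable ↥H) :
    (∀ K : Subgroup G, K.FG) ↔
      ∃ H : Subgroup G, H.FiniteIndex ∧ IsPolycyclic ↥H := by
  constructor
  · intro hG
    obtain ⟨H, hfi, hsol⟩ := hvs
    have : Group.IsSolvable H := hsol
    refine ⟨H, hfi, isPolycyclic_of_isSolvable_of_fg fun K ↦ ?_⟩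
    have hK := (Group.fg_iff_subgroup_fg _).2 (hG (K.map H.subtype))
    exact (Group.fg_iff_subgroup_fg K).1 (Group.fg_of_surjective
      (f := (K.equivMapOfInjective H.subtype H.subtype_injective).symm.toMonoidHom)
      (K.equivMapOfInjective H.subtype H.subtype_injective).symm.surjective)
  · rintro ⟨H, hfi, hpoly⟩ K
    refine .of_inf_of_finiteIndex (H := H) ?_
    have hK := (Group.fg_iff_subgroup_fg _).2 (hpoly.fg_subgroup (K.subgroupOf H))
    rw [← Subgroup.subgroupOf_map_subtype, ← Group.fg_iff_subgroup_fg]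
    exact Group.fg_of_surjective
      (f := ((K.subgroupOf H).equivMapOfInjective H.subtype H.subtype_injective).toMonoidHom)
      ((K.subgroupOf H).equivMapOfInjective H.subtype H.subtype_injective).surjective
end

section
/- The infinite dihedral group, realized as the free product (ZMod 2) ∗ (ZMod 2) of two groups of order two, satisfies the maximal condition on subgroups: every subgroup of (ZMod 2) ∗ (ZMod 2) is finitely generated. -/
/-- If any two elements outside the cyclic subgroup generated by `t` lie in the same right coset
of it, then every subgroup is finitely generated. -/
theorem Subgroup.fg_of_mul_inv_mem_zpowers {G : Type*} [Group G] (t : G)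
    (ht : ∀ x y : G, x ∉ zpowers t → y ∉ zpowers t → x * y⁻¹ ∈ zpowers t) (H : Subgroup G) :
    H.FG := by
  have hinf : (H ⊓ zpowers t).FG := by
    obtain ⟨s, hs⟩ := (Subgroup.isCyclic_iff_exists_zpowers_eq_top (H ⊓ zpowers t)).1
      (isCyclic_of_le inf_le_right)
    exact ⟨{s}, by rw [Finset.coe_singleton, ← zpowers_eq_closure, hs]⟩
  by_cases hH : H ≤ zpowers t
  · rwa [inf_eq_left.2 hH] at hinf
  · obtain ⟨h, hh, hht⟩ := SetLike.not_le_iff_exists.1 hH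
    have hsup : H = (H ⊓ zpowers t) ⊔ zpowers h := by
      refine le_antisymm (fun g hg => ?_) (sup_le inf_le_left (zpowers_le.2 hh))
      by_cases hgt : g ∈ zpowers t
      · exact mem_sup_left ⟨hg, hgt⟩
      · have := mul_mem_sup (S := H ⊓ zpowers t)
          ⟨H.mul_mem hg (H.inv_mem hh), ht g h hgt hht⟩ (mem_zpowers h)
        rwa [inv_mul_cancel_right] at this
    rw [hsup]
    exact hinf.sup ⟨{h}, by rw [Finset.coe_singleton, ← zpowers_eq_closure]⟩

/-- Every element of the free product of two groups of order two is a power of the product of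
the two generators, or such a power times the first generator. -/
theorem Monoid.Coprod.exists_zpow_or_zpow_mul
    (g : Monoid.Coprod (Multiplicative (ZMod 2)) (Multiplicative (ZMod 2))) :
    ∃ k : ℤ, g = (inl (.ofAdd 1) * inr (.ofAdd 1)) ^ k ∨
      g = (inl (.ofAdd 1) * inr (.ofAdd 1)) ^ k * inl (.ofAdd 1) := by
  have hZ : ∀ x : Multiplicative (ZMod 2), x = 1 ∨ x = .ofAdd 1 := by decide
  have hsq : (.ofAdd 1 * .ofAdd 1 : Multiplicative (ZMod 2)) = 1 := by decide
  set a : Monoid.Coprod (Multiplicative (ZMod 2)) (Multiplicative (ZMod 2)) :=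
    inl (.ofAdd 1) with ha
  set b : Monoid.Coprod (Multiplicative (ZMod 2)) (Multiplicative (ZMod 2)) :=
    inr (.ofAdd 1) with hb
  have haa : a * a = 1 := by rw [ha, ← map_mul, hsq, map_one]
  have hbb : b * b = 1 := by rw [hb, ← map_mul, hsq, map_one]
  have hb_eq : b = a * (a * b) := by rw [← mul_assoc, haa, one_mul]
  have hconj : SemiconjBy a (a * b) (a * b)⁻¹ := by
    rw [SemiconjBy, mul_inv_rev, inv_eq_of_mul_eq_one_left haa, inv_eq_of_mul_eq_one_left hbb,
      mul_assoc, haa, mul_one, ← hb_eq]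
  have hpow (k : ℤ) : a * (a * b) ^ k = (a * b) ^ (-k) * a := by
    rw [zpow_neg, ← inv_zpow]
    exact hconj.zpow_right k
  have hmul (g) (hg : ∃ k : ℤ, g = (a * b) ^ k ∨ g = (a * b) ^ k * a) :
      ∃ k : ℤ, a * g = (a * b) ^ k ∨ a * g = (a * b) ^ k * a := by
    obtain ⟨k, rfl | rfl⟩ := hg
    · exact ⟨-k, .inr (hpow k)⟩
    · exact ⟨-k, .inl (by rw [← mul_assoc, hpow, mul_assoc, haa, mul_one])⟩
  induction g using Monoid.Coprod.induction_on' with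
  | one => exact ⟨0, .inl (zpow_zero _).symm⟩
  | inl_mul x g hg =>
    obtain rfl | rfl := hZ x
    · simpa only [map_one, one_mul] using hg
    · exact hmul g hg
  | inr_mul x g hg =>
    obtain rfl | rfl := hZ x
    · simpa only [map_one, one_mul] using hg
    · have hbg : b * g = a * (a * b * g) := by rw [← mul_assoc, ← hb_eq]
      rw [← hb, hbg]
      apply hmul
      obtain ⟨k, rfl | rfl⟩ := hg
      · exact ⟨1 + k, .inl (zpow_one_add _ _).symm⟩
      · exact ⟨1 + k, .inr (by rw [zpow_one_add, mul_assoc (a * b)])⟩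

/-- The infinite dihedral group, realized as the free product of two copies of the
group of order two, satisfies the maximal condition on subgroups: every subgroup
is finitely generated. -/
theorem stmt_19 :
    ∀ H : Subgroup (Monoid.Coprod (Multiplicative (ZMod 2)) (Multiplicative (ZMod 2))),
      H.FG := by
  refine Subgroup.fg_of_mul_inv_mem_zpowers
    (Monoid.Coprod.inl (.ofAdd 1) * Monoid.Coprod.inr (.ofAdd 1)) fun x y hx hy => ?_
  obtain ⟨k, rfl | rfl⟩ := Monoid.Coprod.exists_zpow_or_zpow_mul x
  · exact absurd (Subgroup.zpow_mem_zpowers _ k) hx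
  obtain ⟨l, rfl | rfl⟩ := Monoid.Coprod.exists_zpow_or_zpow_mul y
  · exact absurd (Subgroup.zpow_mem_zpowers _ l) hy
  rw [← div_eq_mul_inv, mul_div_mul_right_eq_div]
  exact Subgroup.div_mem _ (Subgroup.zpow_mem_zpowers _ k) (Subgroup.zpow_mem_zpowers _ l)
end
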